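/- A nonnegative matrix M with rank(M) ≥ 2 is a slack matrix of some polytope if and only if the 0/1-matrix inc(M) (with (inc(M))_{ij} = 1 iff M_{ij} = 0) is an incidence matrix of some polytope of dimension rank(M) − 1 and the all-ones vector 𝟙 is contained in the column span of M. -/

import Mathlib

open Matrix Set

/-- The cone generated by the rows of the matrix `A`, i.e. the set of all
nonnegative linear combinations of the rows of `A`. -/
def coneOfRows {p n : ℕ} (A : Matrix (Fin p) (Fin n) ℝ) : Set (Fin n → ℝ) :=
  {x | ∃ y : Fin p → ℝ, 0 ≤ y ∧ x = Matrix.vecMul y A}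

/-- `M` is the slack matrix of the polyhedral cone `K` with respect to the
representation `(A, B)`: `K = {x | xᵀB ≥ 0} = cone(rows A)` and `M = A * B`. -/
def IsSlackMatrixOfConeRep {p q n : ℕ} (M : Matrix (Fin p) (Fin q) ℝ)
    (K : Set (Fin n → ℝ)) (A : Matrix (Fin p) (Fin n) ℝ)
    (B : Matrix (Fin n) (Fin q) ℝ) : Prop :=
  K = {x | 0 ≤ Matrix.vecMul x B} ∧ K = coneOfRows A ∧ M = A * B

/-- `M` is a slack matrix of some polyhedral cone. -/
def IsSlackMatrixOfCone {p q : ℕ} (M : Matrix (Fin p) (Fin q) ℝ) : Prop :=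
  ∃ (n : ℕ) (A : Matrix (Fin p) (Fin n) ℝ) (B : Matrix (Fin n) (Fin q) ℝ),
    {x : Fin n → ℝ | 0 ≤ Matrix.vecMul x B} = coneOfRows A ∧ M = A * B

/-- The row cone generating condition: the cone generated by the rows of `M`
equals the intersection of the row span of `M` with the nonnegative orthant. -/
def RCGC {p q : ℕ} (M : Matrix (Fin p) (Fin q) ℝ) : Prop :=
  {z : Fin q → ℝ | ∃ y : Fin p → ℝ, 0 ≤ y ∧ z = Matrix.vecMul y M} =
    {z : Fin q → ℝ | (∃ y : Fin p → ℝ, z = Matrix.vecMul y M) ∧ 0 ≤ z}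

/-- The column cone generating condition: the cone generated by the columns of `M`
equals the intersection of the column span of `M` with the nonnegative orthant. -/
def CCGC {p q : ℕ} (M : Matrix (Fin p) (Fin q) ℝ) : Prop :=
  {z : Fin p → ℝ | ∃ c : Fin q → ℝ, 0 ≤ c ∧ z = M.mulVec c} =
    {z : Fin p → ℝ | (∃ c : Fin q → ℝ, z = M.mulVec c) ∧ 0 ≤ z}

/-- The convex hull of the rows of `V`. -/
def rowsConv {p n : ℕ} (V : Matrix (Fin p) (Fin n) ℝ) : Set (Fin n → ℝ) :=
  convexHull ℝ (Set.range fun i => V i)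

/-- `S` is a slack matrix of the polytope `P ⊆ ℝⁿ` (of dimension at least one):
there are `V`, `W`, `w` with `P = conv(rows V) = {x | Wx ≤ w}` and
`S i j = w j - ⟨row j of W, row i of V⟩`. -/
def IsSlackMatrixOfPolytopeOn {p q n : ℕ} (S : Matrix (Fin p) (Fin q) ℝ)
    (P : Set (Fin n → ℝ)) : Prop :=
  ∃ (V : Matrix (Fin p) (Fin n) ℝ) (W : Matrix (Fin q) (Fin n) ℝ) (w : Fin q → ℝ),
    P = rowsConv V ∧ P = {x | W.mulVec x ≤ w} ∧
    (∃ u ∈ P, ∃ v ∈ P, u ≠ v) ∧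
    (∀ i j, S i j = w j - ∑ k, W j k * V i k)

/-- `S` is a slack matrix of some polytope (of dimension at least one). -/
def IsSlackMatrixOfPolytope {p q : ℕ} (S : Matrix (Fin p) (Fin q) ℝ) : Prop :=
  ∃ (n : ℕ) (P : Set (Fin n → ℝ)), IsSlackMatrixOfPolytopeOn S P

/-- A cone is pointed if its lineality space is trivial, i.e. it contains no
nonzero `x` together with `-x`. -/
def IsPointedCone {n : ℕ} (K : Set (Fin n → ℝ)) : Prop :=
  ∀ x ∈ K, -x ∈ K → x = 0

/-- The dimension of a cone: the dimension of its linear hull. -/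
noncomputable def coneDim {n : ℕ} (K : Set (Fin n → ℝ)) : ℕ :=
  Module.finrank ℝ (Submodule.span ℝ K)

/-- The (affine) dimension of a set: the dimension of its affine hull. -/
noncomputable def affDim {n : ℕ} (P : Set (Fin n → ℝ)) : ℕ :=
  Module.finrank ℝ (affineSpan ℝ P).direction

/-- The 0/1 incidence pattern of a matrix: `(inc M) i j = 1` iff `M i j = 0`. -/
noncomputable def inc {p q : ℕ} (M : Matrix (Fin p) (Fin q) ℝ) : Matrix (Fin p) (Fin q) ℝ :=
  Matrix.of fun i j => if M i j = 0 then 1 else 0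

/-- `M'` is obtained from `M` by adding zero rows (keeping the order of the
original rows). -/
def AddZeroRows {p p' q : ℕ} (M : Matrix (Fin p) (Fin q) ℝ)
    (M' : Matrix (Fin p') (Fin q) ℝ) : Prop :=
  ∃ φ : Fin p → Fin p', StrictMono φ ∧ (∀ i, M' (φ i) = M i) ∧
    ∀ i', i' ∉ Set.range φ → M' i' = 0

/-- The polar of a set `P`. -/
def polarSet {n : ℕ} (P : Set (Fin n → ℝ)) : Set (Fin n → ℝ) :=
  {y | ∀ x ∈ P, ∑ i, x i * y i ≤ 1}

section ConeGeneration

variable {ι κ : Type*}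

/-- Every nonnegative vector in the span of the vectors `s i`, `i ∈ I`, is a nonnegative
combination of these vectors. -/
def ConeGenerating (s : ι → κ → ℝ) (I : Finset ι) : Prop :=
  ∀ x ∈ Submodule.span ℝ (s '' I), 0 ≤ x →
    ∃ y : ι → ℝ, (∀ i ∈ I, 0 ≤ y i) ∧ x = ∑ i ∈ I, y i • s i

/-- On the span of the vectors `s i`, `i ∈ I`, nonnegativity of the coordinates in `J`
implies nonnegativity of all coordinates. -/
def SufficientCoords (s : ι → κ → ℝ) (I : Finset ι) (J : Finset κ) : Prop :=
  ∀ x ∈ Submodule.span ℝ (s '' I), (∀ j ∈ J, 0 ≤ x j) → 0 ≤ x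

/-- The vectors in `I` whose `j`-th coordinate vanishes. -/
noncomputable def coordFace (s : ι → κ → ℝ) (I : Finset ι) (j : κ) : Finset ι :=
  I.filter fun i => s i j = 0

theorem coordFace_subset (s : ι → κ → ℝ) (I : Finset ι) (j : κ) : coordFace s I j ⊆ I :=
  Finset.filter_subset _ _

theorem span_image_mono (s : ι → κ → ℝ) {I I' : Finset ι} (h : I ⊆ I') :
    Submodule.span ℝ (s '' I) ≤ Submodule.span ℝ (s '' I') :=
  Submodule.span_mono (Set.image_mono (Finset.coe_subset.mpr h))

theorem SufficientCoords.mono {s : ι → κ → ℝ} {I I' : Finset ι} {J : Finset κ}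
    (h : SufficientCoords s I J) (hI : I' ⊆ I) : SufficientCoords s I' J :=
  fun x hx => h x (span_image_mono s hI hx)

theorem sum_smul_mem_span_image (s : ι → κ → ℝ) (I : Finset ι) (y : ι → ℝ) :
    ∑ i ∈ I, y i • s i ∈ Submodule.span ℝ (s '' I) :=
  Submodule.sum_mem _ fun i hi =>
    Submodule.smul_mem _ _ (Submodule.subset_span ⟨i, hi, rfl⟩)

theorem apply_eq_zero_of_mem_span_image {s : ι → κ → ℝ} {I : Finset ι} {j : κ}
    (h : ∀ i ∈ I, s i j = 0) {x : κ → ℝ} (hx : x ∈ Submodule.span ℝ (s '' I)) : x j = 0 := by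
  have : Submodule.span ℝ (s '' I) ≤ LinearMap.ker (LinearMap.proj (R := ℝ) (φ := fun _ => ℝ) j) := by
    rw [Submodule.span_le]
    rintro _ ⟨i, hi, rfl⟩
    simpa using h i hi
  simpa using this hx

/-- If a nonnegative combination has vanishing `j`-th coordinate, only the vectors with
vanishing `j`-th coordinate contribute. -/
theorem sum_smul_eq_sum_coordFace {s : ι → κ → ℝ} (hs : ∀ i j, 0 ≤ s i j) {I : Finset ι}
    {y : ι → ℝ} (hy : ∀ i ∈ I, 0 ≤ y i) {j : κ} (h : (∑ i ∈ I, y i • s i) j = 0) :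
    ∑ i ∈ I, y i • s i = ∑ i ∈ coordFace s I j, y i • s i := by
  symm
  apply Finset.sum_subset (coordFace_subset s I j)
  intro i hi hi'
  have h0 : y i * s i j = 0 := by
    have : ∑ i ∈ I, y i * s i j = 0 := by simpa [Finset.sum_apply] using h
    exact (Finset.sum_eq_zero_iff_of_nonneg
      fun i hi => mul_nonneg (hy i hi) (hs i j)).mp this i hi
  have h1 : s i j ≠ 0 := fun h => hi' (Finset.mem_filter.mpr ⟨hi, h⟩)
  simp [(mul_eq_zero.mp h0).resolve_right h1]

theorem ConeGenerating.restrict_coordFace {s : ι → κ → ℝ} (hs : ∀ i j, 0 ≤ s i j) {I : Finset ι}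
    (h : ConeGenerating s I) (j : κ) : ConeGenerating s (coordFace s I j) := by
  intro x hx hx0
  obtain ⟨y, hy, rfl⟩ := h x (span_image_mono s (coordFace_subset s I j) hx) hx0
  refine ⟨y, fun i hi => hy i (coordFace_subset s I j hi), sum_smul_eq_sum_coordFace hs hy ?_⟩
  exact apply_eq_zero_of_mem_span_image (fun i hi => (Finset.mem_filter.mp hi).2) hx

/-- A coordinate in an irredundant sufficient set cuts out a facet. -/
theorem mem_span_coordFace_of_minimal {s : ι → κ → ℝ} (hs : ∀ i j, 0 ≤ s i j) {I : Finset ι}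
    (h : ConeGenerating s I) {J : Finset κ} (hJ : Minimal (SufficientCoords s I) J) {j : κ}
    (hj : j ∈ J) {v : κ → ℝ} (hv : v ∈ Submodule.span ℝ (s '' I)) (hvj : v j = 0) :
    v ∈ Submodule.span ℝ (s '' coordFace s I j) := by
  classical
  have hne : ∀ k ∈ J, ¬ SufficientCoords s I (J.erase k) := fun k hk hs' =>
    (Finset.erase_ssubset hk).not_subset (hJ.2 hs' (Finset.erase_subset k J))
  set z : κ → ℝ := ∑ i ∈ I, (1 : ℝ) • s i with hz
  have hzmem : z ∈ Submodule.span ℝ (s '' I) := sum_smul_mem_span_image s I fun _ => 1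
  have hzpos : ∀ k ∈ J, 0 < z k := by
    intro k hk
    have hz' : z k = ∑ i ∈ I, s i k := by simp [hz, Finset.sum_apply]
    rw [hz']
    refine (Finset.sum_nonneg fun i _ => hs i k).lt_of_ne fun h0 => hne k hk ?_
    intro x hx hxJ
    refine hJ.1 x hx fun l hl => ?_
    by_cases hlk : l = k
    · subst hlk
      exact (apply_eq_zero_of_mem_span_image
        ((Finset.sum_eq_zero_iff_of_nonneg fun i _ => hs i l).mp h0.symm) hx).ge
    · exact hxJ l (Finset.mem_erase.mpr ⟨hlk, hl⟩)
  obtain ⟨x, hx, hxJ, hx0⟩ : ∃ x ∈ Submodule.span ℝ (s '' I),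
      (∀ k ∈ J.erase j, 0 ≤ x k) ∧ ¬ 0 ≤ x := by
    have := hne j hj
    unfold SufficientCoords at this
    push Not at this
    exact this
  have hxj : x j < 0 := by
    by_contra! hc
    refine hx0 (hJ.1 x hx fun k hk => ?_)
    by_cases hkj : k = j
    · exact hkj ▸ hc
    · exact hxJ k (Finset.mem_erase.mpr ⟨hkj, hk⟩)
  set u : κ → ℝ := z j • x + (-x j) • z with hu
  have humem : u ∈ Submodule.span ℝ (s '' I) :=
    Submodule.add_mem _ (Submodule.smul_mem _ _ hx) (Submodule.smul_mem _ _ hzmem)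
  have huj : u j = 0 := by simp [hu]; ring
  have hupos : ∀ k ∈ J, k ≠ j → 0 < u k := by
    intro k hk hkj
    have h1 := mul_nonneg (hzpos j hj).le (hxJ k (Finset.mem_erase.mpr ⟨hkj, hk⟩))
    have h2 := mul_pos (neg_pos.mpr hxj) (hzpos k hk)
    simp only [hu, Pi.add_apply, Pi.smul_apply, smul_eq_mul]
    linarith
  have key : ∀ x ∈ Submodule.span ℝ (s '' I), x j = 0 → (∀ k ∈ J, 0 ≤ x k) →
      x ∈ Submodule.span ℝ (s '' coordFace s I j) := by
    intro x hx hxj hxJ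
    obtain ⟨y, hy, rfl⟩ := h x hx (hJ.1 x hx hxJ)
    rw [sum_smul_eq_sum_coordFace hs hy hxj]
    exact sum_smul_mem_span_image s _ y
  obtain ⟨t, ht⟩ : ∃ t : ℝ, ∀ k ∈ J, k ≠ j → 0 ≤ t * u k + v k := by
    refine ⟨∑ k ∈ J, |v k| / |u k|, fun k hk hkj => ?_⟩
    have h1 : |v k| / |u k| ≤ ∑ k ∈ J, |v k| / |u k| :=
      Finset.single_le_sum (f := fun k => |v k| / |u k|) (fun _ _ => by positivity) hk
    have h2 := mul_le_mul_of_nonneg_right h1 (hupos k hk hkj).le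
    rw [abs_of_pos (hupos k hk hkj), div_mul_cancel₀ _ (hupos k hk hkj).ne'] at h2
    linarith [neg_abs_le (v k)]
  have huF := key u humem huj fun k hk => by
    by_cases hkj : k = j
    · exact (hkj ▸ huj).ge
    · exact (hupos k hk hkj).le
  have htF := key (t • u + v) (Submodule.add_mem _ (Submodule.smul_mem _ _ humem) hv)
    (by simp [huj, hvj]) fun k hk => by
      by_cases hkj : k = j
      · subst hkj; simp [huj, hvj]
      · exact ht k hk hkj
  exact (Submodule.add_mem_iff_right _ (Submodule.smul_mem _ _ huF)).mp htF

theorem finrank_span_le_coordFace_of_minimal [Fintype κ] {s : ι → κ → ℝ} (hs : ∀ i j, 0 ≤ s i j)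
    {I : Finset ι} (h : ConeGenerating s I) {J : Finset κ}
    (hJ : Minimal (SufficientCoords s I) J) {j : κ} (hj : j ∈ J) :
    Module.finrank ℝ (Submodule.span ℝ (s '' I)) ≤
      Module.finrank ℝ (Submodule.span ℝ (s '' coordFace s I j)) + 1 := by
  set L := Submodule.span ℝ (s '' I)
  let f : L →ₗ[ℝ] ℝ := (LinearMap.proj j).comp L.subtype
  have h1 := f.finrank_range_add_finrank_ker
  have h2 : Module.finrank ℝ (LinearMap.range f) ≤ 1 := by
    simpa using Submodule.finrank_le (LinearMap.range f)
  have h3 : Module.finrank ℝ (LinearMap.ker f) ≤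
      Module.finrank ℝ (Submodule.span ℝ (s '' coordFace s I j)) := by
    rw [← Submodule.finrank_map_subtype_eq]
    refine Submodule.finrank_mono ?_
    rintro _ ⟨v, hv, rfl⟩
    exact mem_span_coordFace_of_minimal hs h hJ hj v.2 hv
  omega

theorem exists_mem_apply_ne_zero_of_minimal {s : ι → κ → ℝ} {I : Finset ι} {J : Finset κ}
    (hJ : Minimal (SufficientCoords s I) J) {j : κ} (hj : j ∈ J) : ∃ i ∈ I, s i j ≠ 0 := by
  classical
  by_contra! h0
  refine (Finset.erase_ssubset hj).not_subset (hJ.2 ?_ (Finset.erase_subset j J))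
  intro x hx hxJ
  refine hJ.1 x hx fun l hl => ?_
  by_cases hlj : l = j
  · subst hlj
    exact (apply_eq_zero_of_mem_span_image h0 hx).ge
  · exact hxJ l (Finset.mem_erase.mpr ⟨hlj, hl⟩)

theorem coordFace_ssubset {s : ι → κ → ℝ} {I : Finset ι} {j : κ} (h : ∃ i ∈ I, s i j ≠ 0) :
    coordFace s I j ⊂ I :=
  Finset.filter_ssubset.mpr h

theorem finrank_span_coordFace_lt [Fintype κ] {s : ι → κ → ℝ} {I : Finset ι} {j : κ}
    (h : ∃ i ∈ I, s i j ≠ 0) :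
    Module.finrank ℝ (Submodule.span ℝ (s '' coordFace s I j)) <
      Module.finrank ℝ (Submodule.span ℝ (s '' I)) := by
  obtain ⟨i, hi, hij⟩ := h
  refine Submodule.finrank_lt_finrank_of_lt
    ((span_image_mono s (coordFace_subset s I j)).lt_of_ne fun he => hij ?_)
  have : s i ∈ Submodule.span ℝ (s '' I) := Submodule.subset_span ⟨i, hi, rfl⟩
  rw [← he] at this
  exact apply_eq_zero_of_mem_span_image (fun i hi => (Finset.mem_filter.mp hi).2) this

theorem exists_minimal_sufficientCoords {s : ι → κ → ℝ} {I : Finset ι} {J : Finset κ}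
    (h : SufficientCoords s I J) : ∃ J' ⊆ J, Minimal (SufficientCoords s I) J' :=
  exists_minimal_le_of_wellFoundedLT _ J h

theorem coordFace_congr {s m : ι → κ → ℝ} (h : ∀ i j, s i j = 0 ↔ m i j = 0) (I : Finset ι)
    (j : κ) : coordFace m I j = coordFace s I j :=
  Finset.filter_congr fun i _ => (h i j).symm

/-- A cone generating family has the least rank among all families with its zero pattern. -/
theorem ConeGenerating.finrank_span_le [Fintype κ] {s m : ι → κ → ℝ} (hs : ∀ i j, 0 ≤ s i j)
    (hsm : ∀ i j, s i j = 0 ↔ m i j = 0) {I : Finset ι} (h : ConeGenerating s I) :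
    Module.finrank ℝ (Submodule.span ℝ (s '' I)) ≤
      Module.finrank ℝ (Submodule.span ℝ (m '' I)) := by
  induction I using Finset.strongInduction with
  | H I ih =>
  obtain ⟨J, -, hJ⟩ := exists_minimal_sufficientCoords
    (J := Finset.univ) (s := s) (I := I) fun x _ hx j => hx j (Finset.mem_univ j)
  obtain rfl | ⟨j, hj⟩ := J.eq_empty_or_nonempty
  · have : Submodule.span ℝ (s '' I) = ⊥ := by
      rw [Submodule.eq_bot_iff]
      intro x hx
      refine le_antisymm ?_ (hJ.1 x hx (by simp))
      simpa using hJ.1 (-x) (Submodule.neg_mem _ hx) (by simp)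
    rw [this]
    simp
  · have h1 := exists_mem_apply_ne_zero_of_minimal hJ hj
    have h2 := ih _ (coordFace_ssubset h1) (h.restrict_coordFace hs j)
    have h3 := finrank_span_le_coordFace_of_minimal hs h hJ hj
    have h4 := finrank_span_coordFace_lt (s := m) (I := I) (j := j)
      (by simpa only [ne_eq, hsm] using h1)
    rw [coordFace_congr hsm] at h4
    omega

/-- Being cone generating transfers between nonnegative families with the same zero pattern
and the same rank. -/
theorem ConeGenerating.exists_eq_sum_of_zero_iff [Fintype κ] {s m : ι → κ → ℝ} (hs : ∀ i j, 0 ≤ s i j)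
    (hm : ∀ i j, 0 ≤ m i j) (hsm : ∀ i j, s i j = 0 ↔ m i j = 0) {I : Finset ι}
    (h : ConeGenerating s I) {J : Finset κ} (hJ : SufficientCoords s I J)
    (hr : Module.finrank ℝ (Submodule.span ℝ (m '' I)) ≤
      Module.finrank ℝ (Submodule.span ℝ (s '' I)))
    {x : κ → ℝ} (hx : x ∈ Submodule.span ℝ (m '' I)) (hxJ : ∀ j ∈ J, 0 ≤ x j) :
    ∃ y : ι → ℝ, (∀ i ∈ I, 0 ≤ y i) ∧ x = ∑ i ∈ I, y i • m i := by
  classical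
  induction I using Finset.strongInduction generalizing J x with
  | H I ih =>
  obtain ⟨J', hJJ', hJ'⟩ := exists_minimal_sufficientCoords hJ
  have onFacet : ∀ x ∈ Submodule.span ℝ (m '' I), (∀ j ∈ J', 0 ≤ x j) →
      (∃ j ∈ J', x j = 0) → ∃ y : ι → ℝ, (∀ i ∈ I, 0 ≤ y i) ∧ x = ∑ i ∈ I, y i • m i := by
    rintro x hx hxJ ⟨j, hj, hxj⟩
    have h1 := exists_mem_apply_ne_zero_of_minimal hJ' hj
    have h2 := (h.restrict_coordFace hs j).finrank_span_le hs hsm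
    have h3 := finrank_span_le_coordFace_of_minimal hs h hJ' hj
    have h1m : ∃ i ∈ I, m i j ≠ 0 := by simpa only [ne_eq, hsm] using h1
    have h4 := finrank_span_coordFace_lt h1m
    have hmem : x ∈ Submodule.span ℝ (m '' coordFace s I j) := by
      set L := Submodule.span ℝ (m '' I)
      have hle : Submodule.span ℝ (m '' coordFace s I j) ≤
          L ⊓ LinearMap.ker (LinearMap.proj (R := ℝ) (φ := fun _ => ℝ) j) := by
        refine le_inf (span_image_mono m (coordFace_subset s I j)) fun v hv => ?_
        exact apply_eq_zero_of_mem_span_image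
          (fun i hi => (hsm i j).mp (Finset.mem_filter.mp hi).2) hv
      have hlt : Module.finrank ℝ ↥(L ⊓ LinearMap.ker
          (LinearMap.proj (R := ℝ) (φ := fun _ => ℝ) j)) < Module.finrank ℝ L := by
        refine Submodule.finrank_lt_finrank_of_lt (inf_le_left.lt_of_ne fun he => ?_)
        obtain ⟨i, hi, hij⟩ := h1m
        have : m i ∈ L := Submodule.subset_span ⟨i, hi, rfl⟩
        rw [← he] at this
        exact hij this.2
      rw [Submodule.eq_of_le_of_finrank_le hle (by omega)]
      exact ⟨hx, hxj⟩
    rw [coordFace_congr hsm] at h4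
    obtain ⟨y, hy, hxy⟩ := ih _ (coordFace_ssubset h1) (h.restrict_coordFace hs j)
      (hJ'.1.mono (coordFace_subset s I j)) (by omega) hmem hxJ
    refine ⟨fun i => if i ∈ coordFace s I j then y i else 0, fun i _ => ?_, ?_⟩
    · dsimp only
      split_ifs with hi
      exacts [hy i hi, le_rfl]
    · rw [hxy]
      simp only [ite_smul, zero_smul, Finset.sum_ite_mem,
        Finset.inter_eq_right.mpr (coordFace_subset s I j)]
  replace hxJ : ∀ j ∈ J', 0 ≤ x j := fun j hj => hxJ j (hJJ' hj)
  by_cases hz : ∀ i ∈ I, m i = 0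
  · refine ⟨0, fun _ _ => le_rfl, ?_⟩
    funext j
    simpa using apply_eq_zero_of_mem_span_image (fun i hi => by simp [hz i hi]) hx
  push Not at hz
  obtain ⟨i, hi, hmi⟩ := hz
  have hpos : ∃ j ∈ J', 0 < m i j := by
    by_contra! hc
    have hsi : s i ∈ Submodule.span ℝ (s '' I) := Submodule.subset_span ⟨i, hi, rfl⟩
    have hneg := hJ'.1 (-s i) (Submodule.neg_mem _ hsi) fun j hj => by
      simp [(hsm i j).mpr (le_antisymm (hc j hj) (hm i j))]
    refine hmi (funext fun j => (hsm i j).mp (le_antisymm ?_ (hs i j)))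
    simpa using hneg j
  obtain ⟨k, hk, hmin⟩ := (J'.filter fun j => 0 < m i j).exists_min_image (fun j => x j / m i j)
    (by obtain ⟨j, hj, hj'⟩ := hpos; exact ⟨j, Finset.mem_filter.mpr ⟨hj, hj'⟩⟩)
  obtain ⟨hkJ, hkpos⟩ := Finset.mem_filter.mp hk
  set t := x k / m i k with ht
  have ht0 : 0 ≤ t := div_nonneg (hxJ k hkJ) hkpos.le
  have hmi' : m i ∈ Submodule.span ℝ (m '' I) := Submodule.subset_span ⟨i, hi, rfl⟩
  obtain ⟨y, hy, hxy⟩ := onFacet (x - t • m i)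
    (Submodule.sub_mem _ hx (Submodule.smul_mem _ _ hmi')) (fun j hj => by
      simp only [Pi.sub_apply, Pi.smul_apply, smul_eq_mul, sub_nonneg]
      rcases (hm i j).eq_or_lt with h0 | h0
      · simpa [← h0] using hxJ j hj
      · exact (le_div_iff₀ h0).mp (hmin j (Finset.mem_filter.mpr ⟨hj, h0⟩)))
    ⟨k, hkJ, by simp [ht, div_mul_cancel₀ _ hkpos.ne']⟩
  refine ⟨y + Pi.single i t, fun l hl => add_nonneg (hy l hl) ?_, ?_⟩
  · by_cases hli : l = i
    · subst hli; simpa using ht0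
    · simp [hli]
  · simp only [Pi.add_apply, add_smul, Finset.sum_add_distrib, ← hxy]
    rw [Finset.sum_eq_single_of_mem i hi (fun l _ hl => by simp [hl])]
    simp

end ConeGeneration

/-- If a linear functional is constantly `1` on a family, the linear span of the family has one
more dimension than its affine span. -/
theorem finrank_span_range_eq_finrank_vectorSpan_add_one {ι E : Type*} [AddCommGroup E]
    [Module ℝ E] [FiniteDimensional ℝ E] [Nonempty ι] (A : ι → E) (g : E →ₗ[ℝ] ℝ)
    (hg : ∀ i, g (A i) = 1) :
    Module.finrank ℝ (Submodule.span ℝ (Set.range A)) =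
      Module.finrank ℝ (vectorSpan ℝ (Set.range A)) + 1 := by
  obtain ⟨i₀⟩ := ‹Nonempty ι›
  have hvec : vectorSpan ℝ (Set.range A) ≤ LinearMap.ker g := by
    rw [vectorSpan_def, Submodule.span_le]
    rintro _ ⟨_, ⟨i, rfl⟩, _, ⟨k, rfl⟩, rfl⟩
    simp [hg]
  have hsup : Submodule.span ℝ (Set.range A) =
      vectorSpan ℝ (Set.range A) ⊔ Submodule.span ℝ {A i₀} := by
    apply le_antisymm
    · rw [Submodule.span_le]
      rintro _ ⟨i, rfl⟩
      rw [SetLike.mem_coe, ← sub_add_cancel (A i) (A i₀)]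
      exact Submodule.add_mem_sup
        (vsub_mem_vectorSpan ℝ (Set.mem_range_self i) (Set.mem_range_self i₀))
        (Submodule.mem_span_singleton_self _)
    · refine sup_le ?_ (Submodule.span_mono (by simp))
      rw [vectorSpan_def, Submodule.span_le]
      rintro _ ⟨_, hi, _, hk, rfl⟩
      exact Submodule.sub_mem _ (Submodule.subset_span hi) (Submodule.subset_span hk)
  have hinf : vectorSpan ℝ (Set.range A) ⊓ Submodule.span ℝ {A i₀} = ⊥ := by
    rw [Submodule.eq_bot_iff]
    rintro x ⟨hx, hx'⟩
    obtain ⟨a, rfl⟩ := Submodule.mem_span_singleton.mp hx'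
    have h0 : g (a • A i₀) = 0 := hvec hx
    have ha : a = 0 := by simpa [hg] using h0
    simp [ha]
  have hne : A i₀ ≠ 0 := fun h => by simpa [h] using hg i₀
  have := Submodule.finrank_sup_add_finrank_inf_eq (vectorSpan ℝ (Set.range A))
    (Submodule.span ℝ {A i₀})
  rw [hinf, ← hsup, finrank_bot, finrank_span_singleton hne] at this
  omega

section Polytope

variable {p q n : ℕ}

theorem eq_zero_of_mulVec_nonpos {V : Matrix (Fin p) (Fin n) ℝ} {W : Matrix (Fin q) (Fin n) ℝ}
    {w : Fin q → ℝ} (hP : rowsConv V = {x | W.mulVec x ≤ w}) {x₀ : Fin n → ℝ}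
    (hx₀ : x₀ ∈ rowsConv V) {d : Fin n → ℝ} (hd : W.mulVec d ≤ 0) : d = 0 := by
  by_contra hd0
  have hbdd : Bornology.IsBounded (rowsConv V) :=
    ((Set.finite_range _).isCompact_convexHull (𝕜 := ℝ)).isBounded
  obtain ⟨C, hC⟩ := hbdd.exists_norm_le
  have hdpos : 0 < ‖d‖ := norm_pos_iff.mpr hd0
  have hC0 : 0 ≤ C := (norm_nonneg _).trans (hC _ hx₀)
  set t : ℝ := (C + ‖x₀‖ + 1) / ‖d‖ with ht
  have ht0 : 0 ≤ t := by positivity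
  have hmem : x₀ + t • d ∈ rowsConv V := by
    rw [hP] at hx₀ ⊢
    intro j
    have h1 := hx₀ j
    have h2 : t * W.mulVec d j ≤ 0 := mul_nonpos_of_nonneg_of_nonpos ht0 (hd j)
    simp only [Matrix.mulVec_add, Matrix.mulVec_smul, Pi.add_apply, Pi.smul_apply, smul_eq_mul]
    linarith
  have h1 := hC _ hmem
  have h2 : ‖t • d‖ ≤ ‖x₀ + t • d‖ + ‖x₀‖ := by
    simpa using norm_sub_le (x₀ + t • d) x₀
  have h3 : ‖t • d‖ = C + ‖x₀‖ + 1 := by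
    rw [norm_smul, Real.norm_of_nonneg ht0, ht, div_mul_cancel₀ _ hdpos.ne']
  linarith

theorem not_le_mulVec {V : Matrix (Fin p) (Fin n) ℝ} {W : Matrix (Fin q) (Fin n) ℝ}
    {w : Fin q → ℝ} (hP : rowsConv V = {x | W.mulVec x ≤ w})
    (hne : ∃ u ∈ rowsConv V, ∃ v ∈ rowsConv V, u ≠ v) (x : Fin n → ℝ) : ¬ w ≤ W.mulVec x := by
  intro hx
  have key : ∀ u ∈ rowsConv V, u = x := fun u hu => by
    refine sub_eq_zero.mp (eq_zero_of_mulVec_nonpos hP hu ?_)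
    have hu' : W.mulVec u ≤ w := by rw [hP] at hu; exact hu
    rw [Matrix.mulVec_sub]
    exact sub_nonpos.mpr (hu'.trans hx)
  obtain ⟨u, hu, v, hv, huv⟩ := hne
  exact huv ((key u hu).trans (key v hv).symm)

/-- The linear map that sends the homogenization `(1, x)` of a point `x` to its slack vector
`w - W x`. -/
noncomputable def slackMap (W : Matrix (Fin q) (Fin n) ℝ) (w : Fin q → ℝ) :
    ℝ × (Fin n → ℝ) →ₗ[ℝ] (Fin q → ℝ) :=
  (LinearMap.fst ℝ ℝ (Fin n → ℝ)).smulRight w - W.mulVecLin.comp (LinearMap.snd ℝ ℝ (Fin n → ℝ))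

theorem slackMap_apply (W : Matrix (Fin q) (Fin n) ℝ) (w : Fin q → ℝ) (a : ℝ) (x : Fin n → ℝ) :
    slackMap W w (a, x) = a • w - W.mulVec x := by
  simp [slackMap]

/-- If a point of the homogenization has nonnegative slack, it lies in the homogenization cone
of the polytope. -/
theorem nonneg_and_of_slackMap_nonneg {V : Matrix (Fin p) (Fin n) ℝ}
    {W : Matrix (Fin q) (Fin n) ℝ} {w : Fin q → ℝ} (hP : rowsConv V = {x | W.mulVec x ≤ w})
    (hne : ∃ u ∈ rowsConv V, ∃ v ∈ rowsConv V, u ≠ v) {a : ℝ} {x : Fin n → ℝ}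
    (h : 0 ≤ slackMap W w (a, x)) : (a = 0 ∧ x = 0) ∨ (0 < a ∧ a⁻¹ • x ∈ rowsConv V) := by
  rw [slackMap_apply, sub_nonneg] at h
  rcases lt_trichotomy a 0 with ha | rfl | ha
  · exfalso
    refine not_le_mulVec hP hne (a⁻¹ • x) fun j => ?_
    have := mul_le_mul_of_nonpos_left (h j) (inv_nonpos.mpr ha.le)
    simpa [Matrix.mulVec_smul, inv_mul_cancel_left₀ ha.ne] using this
  · obtain ⟨u, hu, -⟩ := hne
    exact Or.inl ⟨rfl, eq_zero_of_mulVec_nonpos hP hu (by simpa using h)⟩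
  · refine Or.inr ⟨ha, ?_⟩
    rw [hP]
    intro j
    have := mul_le_mul_of_nonneg_left (h j) (inv_nonneg.mpr ha.le)
    simpa [Matrix.mulVec_smul, inv_mul_cancel_left₀ ha.ne'] using this

theorem ker_slackMap {V : Matrix (Fin p) (Fin n) ℝ} {W : Matrix (Fin q) (Fin n) ℝ}
    {w : Fin q → ℝ} (hP : rowsConv V = {x | W.mulVec x ≤ w})
    (hne : ∃ u ∈ rowsConv V, ∃ v ∈ rowsConv V, u ≠ v) : LinearMap.ker (slackMap W w) = ⊥ := by
  rw [LinearMap.ker_eq_bot']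
  rintro ⟨a, x⟩ h
  have h1 := nonneg_and_of_slackMap_nonneg hP hne h.ge
  have h2 := nonneg_and_of_slackMap_nonneg (a := -a) (x := -x) hP hne (by
    rw [show ((-a, -x) : ℝ × (Fin n → ℝ)) = -(a, x) from rfl, map_neg, h, neg_zero])
  rcases h1 with ⟨rfl, rfl⟩ | ⟨ha, -⟩
  · rfl
  · rcases h2 with ⟨ha', -⟩ | ⟨ha', -⟩ <;> linarith

theorem exists_mulVec_eq_one_of_linearMap {M : Matrix (Fin p) (Fin q) ℝ}
    (g : (Fin q → ℝ) →ₗ[ℝ] ℝ) (hg : ∀ i, g (M.row i) = 1) :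
    ∃ c : Fin q → ℝ, M.mulVec c = 1 := by
  refine ⟨fun j => g fun k => if j = k then 1 else 0, funext fun i => ?_⟩
  exact (LinearMap.pi_apply_eq_sum_univ g (M.row i)).symm.trans (hg i)

theorem mem_rowsConv_iff {V : Matrix (Fin p) (Fin n) ℝ} {x : Fin n → ℝ} :
    x ∈ rowsConv V ↔ ∃ y : Fin p → ℝ, (∀ i, 0 ≤ y i) ∧ ∑ i, y i = 1 ∧ ∑ i, y i • V i = x := by
  have : rowsConv V = Fintype.linearCombination ℝ V.row '' stdSimplex ℝ (Fin p) := by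
    rw [← convexHull_basis_eq_stdSimplex, LinearMap.image_convexHull, ← Set.range_comp, rowsConv]
    congr 2
    ext1 i
    have := Fintype.linearCombination_apply (R := ℝ) V.row fun j => if i = j then (1 : ℝ) else 0
    simp only [ite_smul, one_smul, zero_smul, Finset.sum_ite_eq, Finset.mem_univ, if_true] at this
    exact this.symm
  rw [this]
  constructor
  · rintro ⟨y, hy, rfl⟩
    exact ⟨y, hy.1, hy.2, rfl⟩
  · rintro ⟨y, hy, hy', rfl⟩
    exact ⟨y, ⟨hy, hy'⟩, rfl⟩

/-- A slack matrix of a polytope is nonnegative and cone generating, its rank exceeds the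
dimension of the polytope by one, and its column span contains the all-ones vector. -/
theorem IsSlackMatrixOfPolytopeOn.properties {S : Matrix (Fin p) (Fin q) ℝ}
    {P : Set (Fin n → ℝ)} (h : IsSlackMatrixOfPolytopeOn S P) :
    (∀ i j, 0 ≤ S i j) ∧ ConeGenerating S.row Finset.univ ∧ S.rank = affDim P + 1 ∧
      ∃ c : Fin q → ℝ, S.mulVec c = 1 := by
  obtain ⟨V, W, w, rfl, hP, hne, hS⟩ := h
  have : Nonempty (Fin p) := by
    obtain ⟨u, hu, -⟩ := hne
    exact Set.range_nonempty_iff_nonempty.mp (convexHull_nonempty_iff.mp ⟨u, hu⟩)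
  have hrow : ∀ i, S.row i = slackMap W w (1, V i) := fun i => funext fun j => by
    simp [slackMap_apply, hS, Matrix.mulVec, dotProduct]
  obtain ⟨g', hg'⟩ := (slackMap W w).exists_leftInverse_of_injective (ker_slackMap hP hne)
  let g : (Fin q → ℝ) →ₗ[ℝ] ℝ := (LinearMap.fst ℝ ℝ (Fin n → ℝ)).comp g'
  have hg : ∀ i, g (S.row i) = 1 := fun i => by
    have := LinearMap.congr_fun hg' (1, V i)
    simp only [LinearMap.comp_apply, LinearMap.id_apply] at this
    simp [g, hrow, this]
  refine ⟨fun i j => ?_, fun x hx hx0 => ?_, ?_, exists_mulVec_eq_one_of_linearMap g hg⟩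
  · have hi : V i ∈ rowsConv V := subset_convexHull ℝ _ ⟨i, rfl⟩
    rw [hP] at hi
    have := hi j
    rw [← S.row_apply, hrow, slackMap_apply]
    simpa using this
  · rw [Finset.coe_univ, Set.image_univ, Submodule.mem_span_range_iff_exists_fun] at hx
    obtain ⟨y, rfl⟩ := hx
    have hsum : ∀ y : Fin p → ℝ,
        ∑ i, y i • S.row i = slackMap W w (∑ i, y i, ∑ i, y i • V i) := fun y => by
      simp only [hrow, ← map_smul, ← map_sum]
      congr 1
      ext <;> simp [Prod.fst_sum, Prod.snd_sum]
    rw [hsum] at hx0 ⊢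
    rcases nonneg_and_of_slackMap_nonneg hP hne hx0 with ⟨h1, h2⟩ | ⟨h1, h2⟩
    · refine ⟨0, by simp, ?_⟩
      rw [h1, h2, Prod.mk_zero_zero, map_zero]
      simp
    · obtain ⟨l, hl0, hl1, hl⟩ := mem_rowsConv_iff.mp h2
      refine ⟨(∑ i, y i) • l, fun i _ => mul_nonneg h1.le (hl0 i), ?_⟩
      rw [hsum]
      congr 2
      · simp [← Finset.mul_sum, hl1]
      · simp only [Pi.smul_apply, smul_assoc, ← Finset.smul_sum, hl]
        rw [smul_inv_smul₀ h1.ne']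
  · rw [Matrix.rank_eq_finrank_span_row, finrank_span_range_eq_finrank_vectorSpan_add_one _ g hg,
      affDim, rowsConv, affineSpan_convexHull, direction_affineSpan]
    let L : (Fin n → ℝ) →ₗ[ℝ] (Fin q → ℝ) := slackMap W w ∘ₗ LinearMap.inr ℝ ℝ (Fin n → ℝ)
    have hinj : Function.Injective L :=
      (LinearMap.ker_eq_bot.mp (ker_slackMap hP hne)).comp LinearMap.inr_injective
    have hvec : vectorSpan ℝ (Set.range S.row) =
        (vectorSpan ℝ (Set.range fun i => V i)).map L := by
      have hL : ∀ i k, S.row i - S.row k = L (V i - V k) := fun i k => by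
        simp [hrow, L, slackMap_apply, Matrix.mulVec_sub]
      rw [vectorSpan_def, vectorSpan_def, Submodule.map_span]
      congr 1
      ext x
      simp [Set.mem_vsub, hL]
    rw [hvec, ← (Submodule.equivMapOfInjective L hinj _).finrank_eq]

theorem isSlackMatrixOfPolytope_of_coneGenerating {M : Matrix (Fin p) (Fin q) ℝ}
    (hM : ∀ i j, 0 ≤ M i j) (hrank : 2 ≤ M.rank) (h : ConeGenerating M.row Finset.univ)
    {c : Fin q → ℝ} (hc : M.mulVec c = 1) : IsSlackMatrixOfPolytope M := by
  rw [Matrix.rank_eq_finrank_span_row] at hrank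
  let g : (Fin q → ℝ) →ₗ[ℝ] ℝ := Fintype.linearCombination ℝ c
  have hg : ∀ i, g (M.row i) = 1 := fun i => congrFun hc i
  obtain ⟨i₀, i₁, hne⟩ : ∃ i₀ i₁, M.row i₀ ≠ M.row i₁ := by
    by_contra! hall
    rcases isEmpty_or_nonempty (Fin p) with hp | ⟨⟨i₀⟩⟩
    · rw [Set.range_eq_empty, Submodule.span_empty, finrank_bot] at hrank
      omega
    · have hsub : Set.range M.row ⊆ {M.row i₀} := by
        rintro _ ⟨i, rfl⟩
        exact hall i i₀
      have := (Submodule.finrank_mono (Submodule.span_mono hsub)).trans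
        (finrank_span_le_card (R := ℝ) {M.row i₀})
      rw [Set.toFinset_singleton, Finset.card_singleton] at this
      omega
  let D : Submodule ℝ (Fin q → ℝ) := Submodule.span ℝ (Set.range M.row) ⊓ LinearMap.ker g
  have hspan : ∀ i, M.row i ∈ Submodule.span ℝ (Set.range M.row) := fun i =>
    Submodule.subset_span ⟨i, rfl⟩
  have hD : ∀ i, M.row i - M.row i₀ ∈ D := fun i =>
    ⟨Submodule.sub_mem _ (hspan i) (hspan i₀), by simp [hg]⟩
  let e := (Module.finBasis ℝ D).equivFun
  let L : (Fin (Module.finrank ℝ D) → ℝ) →ₗ[ℝ] (Fin q → ℝ) := D.subtype ∘ₗ e.symm.toLinearMap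
  have hL : Function.Injective L := D.subtype_injective.comp e.symm.injective
  let V : Matrix (Fin p) (Fin (Module.finrank ℝ D)) ℝ := Matrix.of fun i => e ⟨_, hD i⟩
  have hV : ∀ i, L (V i) = M.row i - M.row i₀ := fun i => by
    change ((e.symm (e ⟨_, hD i⟩) : D) : Fin q → ℝ) = _
    rw [e.symm_apply_apply]
  have hW : ∀ x, (-LinearMap.toMatrix' L).mulVec x = -L x := fun x => by
    rw [Matrix.neg_mulVec, LinearMap.toMatrix'_mulVec]
  have hmem : ∀ i, V i ∈ rowsConv V := fun i => subset_convexHull ℝ _ ⟨i, rfl⟩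
  have hsum : ∀ y : Fin p → ℝ, ∑ i, y i = 1 →
      L (∑ i, y i • V i) = ∑ i, y i • M.row i - M.row i₀ := fun y hy => by
    simp only [map_sum, map_smul, hV, smul_sub, Finset.sum_sub_distrib, ← Finset.sum_smul, hy,
      one_smul]
  refine ⟨_, rowsConv V, V, -LinearMap.toMatrix' L, M.row i₀, rfl, ?_,
    ⟨V i₀, hmem i₀, V i₁, hmem i₁, fun hV' => hne ?_⟩, fun i j => ?_⟩
  · ext x
    rw [Set.mem_ofPred_eq, hW, neg_le_iff_add_nonneg', mem_rowsConv_iff]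
    constructor
    · rintro ⟨y, hy, hy1, rfl⟩
      rw [hsum y hy1, sub_add_cancel]
      exact Finset.sum_nonneg fun i _ => smul_nonneg (hy i) (hM i)
    · intro hx
      have hxD : L x ∈ D := (e.symm x).2
      obtain ⟨y, hy, hxy⟩ := h (L x + M.row i₀)
        (by
          rw [Finset.coe_univ, Set.image_univ]
          exact Submodule.add_mem _ hxD.1 (hspan i₀)) hx
      have hy1 : ∑ i, y i = 1 := by
        have h1 := congrArg g hxy
        rw [map_add, hxD.2, hg, map_sum] at h1
        simpa [hg] using h1.symm
      refine ⟨y, fun i => hy i (Finset.mem_univ i), hy1, hL ?_⟩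
      rw [hsum y hy1, ← hxy, add_sub_cancel_right]
  · have h1 := congrArg L hV'
    rw [hV, hV] at h1
    exact sub_left_injective h1
  · change M i j = M i₀ j - (-LinearMap.toMatrix' L).mulVec (V i) j
    rw [hW, Pi.neg_apply, hV]
    simp

end Polytope

/-- **Theorem (combinatorial characterization for polytopes).**
A nonnegative matrix `M` with `rank M ≥ 2` is a slack matrix of some polytope
if and only if `inc M` is an incidence matrix of some `(rank M - 1)`-dimensional
polytope and `𝟙` is contained in the column span of `M`. -/
theorem slack_matrix_of_polytope_iff_incidence {p q : ℕ}
    (M : Matrix (Fin p) (Fin q) ℝ) (hM : ∀ i j, 0 ≤ M i j) (hrank : 2 ≤ M.rank) :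
    IsSlackMatrixOfPolytope M ↔
      ((∃ (n : ℕ) (P : Set (Fin n → ℝ)) (S : Matrix (Fin p) (Fin q) ℝ),
          IsSlackMatrixOfPolytopeOn S P ∧ affDim P = M.rank - 1 ∧ inc S = inc M) ∧
        ∃ c : Fin q → ℝ, M.mulVec c = 1) := by
  constructor
  · rintro ⟨n, P, h⟩
    obtain ⟨-, -, hr, hc⟩ := h.properties
    exact ⟨⟨n, P, M, h, by omega, rfl⟩, hc⟩
  · rintro ⟨⟨n, P, S, h, hdim, hinc⟩, c, hc⟩
    obtain ⟨hS, hcone, hr, -⟩ := h.properties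
    have hzero : ∀ i j, S i j = 0 ↔ M i j = 0 := fun i j => by
      have := congrFun (congrFun hinc i) j
      simp only [inc, Matrix.of_apply] at this
      by_cases h1 : S i j = 0 <;> by_cases h2 : M i j = 0 <;> simp [h1, h2] at this ⊢
    refine isSlackMatrixOfPolytope_of_coneGenerating hM hrank (fun x hx hx0 => ?_) hc
    refine hcone.exists_eq_sum_of_zero_iff (s := S.row) (m := M.row) (J := Finset.univ) hS hM hzero
      (fun x _ hxJ j => hxJ j (Finset.mem_univ j)) ?_ hx fun j _ => hx0 j
    rw [Finset.coe_univ, Set.image_univ, Set.image_univ, ← Matrix.rank_eq_finrank_span_row,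
      ← Matrix.rank_eq_finrank_span_row]
    omega
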